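/- arXiv:math/0202086 — 7 statements merged into one kernel-verified Lean document; each statement's English description precedes it below -/
import Mathlib

section
/- If φ : ℝⁿ → ℤ is a finite sum of signs of real polynomials, then the function x ↦ (φ(x)⁴ − φ(x)²)/2 takes integer values at every point and is again a finite sum of signs of real polynomials. -/
open MvPolynomial

/-- The sign of a real number, as an integer: 1 if positive, -1 if negative, 0 if zero. -/
noncomputable def sgn (t : ℝ) : ℤ := if 0 < t then 1 else if t < 0 then -1 else 0

/-- A function `φ : ℝⁿ → ℤ` is a finite sum of signs of real polynomials if there are
polynomials `g₁, …, g_s` with `φ x = Σᵢ sgn (gᵢ x)` for all `x`. -/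
def IsSumOfSigns (n : ℕ) (φ : (Fin n → ℝ) → ℤ) : Prop :=
  ∃ (s : ℕ) (g : Fin s → MvPolynomial (Fin n) ℝ),
    ∀ x : Fin n → ℝ, φ x = ∑ i : Fin s, sgn (eval x (g i))

theorem sgn_eq_sign (t : ℝ) : sgn t = (SignType.sign t : ℤ) := by
  unfold sgn
  rw [sign_apply]
  split_ifs <;> rfl

theorem sgn_mul (a b : ℝ) : sgn (a * b) = sgn a * sgn b := by
  simp only [sgn_eq_sign, sign_mul, SignType.coe_mul]

theorem sgn_neg (a : ℝ) : sgn (-a) = -sgn a := by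
  simp only [sgn_eq_sign, Left.sign_neg, SignType.coe_neg]

theorem sgn_pow_four (t : ℝ) : sgn t ^ 4 = sgn t ^ 2 := by
  unfold sgn
  split_ifs <;> norm_num

namespace IsSumOfSigns

variable {n : ℕ} {φ ψ : (Fin n → ℝ) → ℤ}

theorem zero : IsSumOfSigns n 0 := ⟨0, Fin.elim0, fun x => by simp⟩

theorem sgn_eval (p : MvPolynomial (Fin n) ℝ) : IsSumOfSigns n (fun x => sgn (eval x p)) :=
  ⟨1, fun _ => p, fun x => by simp⟩

theorem add (hφ : IsSumOfSigns n φ) (hψ : IsSumOfSigns n ψ) : IsSumOfSigns n (φ + ψ) := by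
  obtain ⟨s, g, hg⟩ := hφ
  obtain ⟨t, h, hh⟩ := hψ
  exact ⟨s + t, Fin.append g h, fun x => by simp [Fin.sum_univ_add, hg, hh]⟩

theorem neg (hφ : IsSumOfSigns n φ) : IsSumOfSigns n (-φ) := by
  obtain ⟨s, g, hg⟩ := hφ
  exact ⟨s, fun i => -g i, fun x => by simp [sgn_neg, hg]⟩

theorem mul_sgn_eval (hφ : IsSumOfSigns n φ) (p : MvPolynomial (Fin n) ℝ) :
    IsSumOfSigns n (φ * fun x => sgn (eval x p)) := by
  obtain ⟨s, g, hg⟩ := hφ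
  exact ⟨s, fun i => g i * p, fun x => by simp [sgn_mul, hg, Finset.sum_mul]⟩

/-- Sums of signs are generated from `0` by adding one sign at a time. -/
theorem induction_on {motive : ((Fin n → ℝ) → ℤ) → Prop} (hφ : IsSumOfSigns n φ)
    (zero : motive 0)
    (add_sgn : ∀ (ψ : (Fin n → ℝ) → ℤ) (p : MvPolynomial (Fin n) ℝ), IsSumOfSigns n ψ →
      motive ψ → motive (ψ + fun x => sgn (eval x p))) : motive φ := by
  obtain ⟨s, g, hg⟩ := hφ
  induction s generalizing φ with
  | zero =>
    have h : φ = 0 := funext fun x => by simp [hg]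
    exact h ▸ zero
  | succ s ih =>
    have h : φ = (fun x => ∑ i : Fin s, sgn (eval x (g i.castSucc))) +
        fun x => sgn (eval x (g (Fin.last s))) :=
      funext fun x => by simp [hg, Fin.sum_univ_castSucc]
    rw [h]
    exact add_sgn _ _ ⟨s, fun i => g i.castSucc, fun _ => rfl⟩
      (ih (fun i => g i.castSucc) fun _ => rfl)

theorem mul (hφ : IsSumOfSigns n φ) (hψ : IsSumOfSigns n ψ) : IsSumOfSigns n (φ * ψ) := by
  refine hψ.induction_on (motive := fun ψ => IsSumOfSigns n (φ * ψ)) ?_ fun ψ p _ ih => ?_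
  · simpa only [mul_zero] using zero
  · simpa only [mul_add] using ih.add (hφ.mul_sgn_eval p)

end IsSumOfSigns

theorem two_dvd_pow_four_sub_sq (a : ℤ) : (2 : ℤ) ∣ a ^ 4 - a ^ 2 := by
  have h : a ^ 4 - a ^ 2 = a ^ 2 * (a ^ 2 - 1) := by ring
  rw [h]
  exact (Int.even_mul_pred_self (a ^ 2)).two_dvd

theorem half_pow_four_sub_sq_add (a b : ℤ) (hb : b ^ 4 = b ^ 2) :
    ((a + b) ^ 4 - (a + b) ^ 2) / 2 =
      (a ^ 4 - a ^ 2) / 2 + (2 * a ^ 3 * b + 3 * a ^ 2 * b ^ 2 + 2 * a * b ^ 3 - a * b) := by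
  rw [← Int.add_mul_ediv_right _ _ two_ne_zero]
  congr 1
  linear_combination hb

theorem half_pow_four_sub_sq_of_sumOfSigns (n : ℕ) (φ : (Fin n → ℝ) → ℤ)
    (hφ : IsSumOfSigns n φ) :
    (∀ x, (2 : ℤ) ∣ (φ x ^ 4 - φ x ^ 2)) ∧
      IsSumOfSigns n (fun x => (φ x ^ 4 - φ x ^ 2) / 2) := by
  refine ⟨fun x => two_dvd_pow_four_sub_sq (φ x), ?_⟩
  refine hφ.induction_on
    (motive := fun φ => IsSumOfSigns n fun x => (φ x ^ 4 - φ x ^ 2) / 2) ?_ fun ψ p hψ ih => ?_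
  · convert IsSumOfSigns.zero using 1
    funext x
    simp
  · have hσ := IsSumOfSigns.sgn_eval p
    set σ : (Fin n → ℝ) → ℤ := fun x => sgn (eval x p)
    have hψσ := hψ.mul hσ
    have hr := (((hψ.mul hψ).add (hψ.mul hψ)).add ((hψσ.add hψσ).add hψσ)).add
      ((hσ.mul hσ).add (hσ.mul hσ))
    convert ih.add ((hψσ.mul hr).add hψσ.neg) using 1
    funext x
    simp only [Pi.add_apply, Pi.mul_apply, Pi.neg_apply]
    rw [half_pow_four_sub_sq_add _ _ (sgn_pow_four _)]
    ring
end

section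
/- Let P ∈ ℝ[z] be a monic polynomial of degree s ≥ 1 and let r₁, …, r_s ∈ ℂ be its complex roots listed with multiplicity. For k ≥ 0 let p_k = Σᵢ₌₁ˢ rᵢᵏ be the k-th Newton power sum. Then each p_k is a real number, and the s × s real symmetric matrix H with entries H_{ij} = p_{i+j−2} (for 1 ≤ i, j ≤ s) has signature equal to the number of distinct real roots of P, where the signature of a real symmetric matrix is the number of its positive eigenvalues minus the number of its negative eigenvalues (counted with multiplicity). -/
open Polynomial

open QuadraticMap in
/-- Precomposing a quadratic form with a surjective linear map preserves the maximal dimension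
of a positive definite subspace. -/
theorem QuadraticForm.sigPos_comp_of_surjective {K M N : Type*} [Field K] [LinearOrder K]
    [AddCommGroup M] [Module K M] [FiniteDimensional K M]
    [AddCommGroup N] [Module K N] [FiniteDimensional K N]
    (Q : QuadraticForm K N) (f : M →ₗ[K] N) (hf : Function.Surjective f) :
    sigPos (Q.comp f) = sigPos Q := by
  apply le_antisymm
  · obtain ⟨V, hV, hpos⟩ := exists_finrank_eq_sigPos_and_posDef (Q.comp f)
    have hker : LinearMap.ker (f.domRestrict V) = ⊥ := by
      rw [LinearMap.ker_eq_bot']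
      intro x hx
      by_contra h
      have h1 := hpos x h
      have h2 : f x = 0 := hx
      simp [h2] at h1
    rw [← hV, ← LinearMap.finrank_range_of_inj (LinearMap.ker_eq_bot.1 hker)]
    apply le_sigPos_of_posDef
    rintro ⟨_, x, rfl⟩ hx
    refine hpos x ?_
    rintro rfl
    exact hx (by simp)
  · obtain ⟨V, hV, hpos⟩ := exists_finrank_eq_sigPos_and_posDef Q
    obtain ⟨g, hg⟩ := f.exists_rightInverse_of_surjective (LinearMap.range_eq_top.2 hf)
    have hfg : ∀ y, f (g y) = y := fun y => LinearMap.congr_fun hg y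
    have hinj : Function.Injective g := Function.LeftInverse.injective hfg
    rw [← hV, LinearEquiv.finrank_eq (V.equivMapOfInjective g hinj)]
    apply le_sigPos_of_posDef
    rintro ⟨_, y, hy, rfl⟩ hx
    have h1 : (⟨y, hy⟩ : V) ≠ 0 := by
      rintro h
      have : y = 0 := congrArg Subtype.val h
      subst this
      exact hx (by simp)
    simpa [restrict_apply, hfg] using hpos ⟨y, hy⟩ h1

open QuadraticMap in
/-- If a weighted sum of squares pulls back along two surjective linear maps to the same form,
the numbers of positive weights agree. -/
theorem card_pos_weights_eq {M ι κ : Type*} [AddCommGroup M] [Module ℝ M] [FiniteDimensional ℝ M]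
    [Fintype ι] [Fintype κ] (w : ι → ℝ) (u : κ → ℝ)
    (f : M →ₗ[ℝ] ι → ℝ) (g : M →ₗ[ℝ] κ → ℝ)
    (hf : Function.Surjective f) (hg : Function.Surjective g)
    (h : ∀ x, ∑ i, w i * f x i ^ 2 = ∑ j, u j * g x j ^ 2) :
    (Finset.univ.filter fun i => 0 < w i).card = (Finset.univ.filter fun j => 0 < u j).card := by
  have hQ : (weightedSumSquares ℝ w).comp f = (weightedSumSquares ℝ u).comp g := by
    ext x
    simpa [weightedSumSquares_apply, pow_two] using h x
  have := congrArg sigPos hQ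
  rw [QuadraticForm.sigPos_comp_of_surjective _ _ hf,
    QuadraticForm.sigPos_comp_of_surjective _ _ hg, QuadraticForm.sigPos_weightedSumSquares,
    QuadraticForm.sigPos_weightedSumSquares] at this
  simpa [Set.ncard_eq_toFinset_card'] using this

/-- If a weighted sum of squares pulls back along two surjective linear maps to the same form,
the numbers of negative weights agree. -/
theorem card_neg_weights_eq {M ι κ : Type*} [AddCommGroup M] [Module ℝ M] [FiniteDimensional ℝ M]
    [Fintype ι] [Fintype κ] (w : ι → ℝ) (u : κ → ℝ)
    (f : M →ₗ[ℝ] ι → ℝ) (g : M →ₗ[ℝ] κ → ℝ)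
    (hf : Function.Surjective f) (hg : Function.Surjective g)
    (h : ∀ x, ∑ i, w i * f x i ^ 2 = ∑ j, u j * g x j ^ 2) :
    (Finset.univ.filter fun i => w i < 0).card = (Finset.univ.filter fun j => u j < 0).card := by
  simpa using card_pos_weights_eq (-w) (-u) f g hf hg (by simpa using h)

/-- A real symmetric matrix is diagonalized, as a quadratic form, by an invertible change of
coordinates with its eigenvalues as weights. -/
theorem Matrix.IsHermitian.exists_surjective_sum_eigenvalues {n : Type*} [Fintype n]
    [DecidableEq n] {A : Matrix n n ℝ} (hA : A.IsHermitian) :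
    ∃ f : (n → ℝ) →ₗ[ℝ] n → ℝ, Function.Surjective f ∧
      ∀ v, ∑ i, hA.eigenvalues i * f v i ^ 2 = v ⬝ᵥ (A.mulVec v) := by
  set U : Matrix n n ℝ := (hA.eigenvectorUnitary : Matrix n n ℝ) with hU
  have hUU : star U * U = 1 := by simp [hU]
  refine ⟨(star U).mulVecLin, fun y => ⟨U.mulVec y, by simp [hUU]⟩, fun v => ?_⟩
  have h : A = U * Matrix.diagonal hA.eigenvalues * star U := by
    conv_lhs => rw [hA.spectral_theorem]
    rfl
  conv_rhs => rw [h]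
  rw [← Matrix.mulVec_mulVec, ← Matrix.mulVec_mulVec, Matrix.dotProduct_mulVec,
    ← Matrix.mulVec_transpose]
  have h2 : Matrix.transpose U = star U := by
    rw [Matrix.star_eq_conjTranspose, Matrix.conjTranspose_eq_transpose_of_trivial]
  rw [h2]
  simp only [dotProduct, Matrix.mulVec_diagonal, Matrix.mulVecLin_apply]
  exact Finset.sum_congr rfl fun i _ => by ring

open ComplexConjugate

/-- Interpolation by real polynomials at a conjugation-stable set of complex nodes. -/
theorem exists_real_coeff_interpolation (S : Finset ℂ) (n : ℕ) (hn : S.card ≤ n)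
    (hS : ∀ z ∈ S, conj z ∈ S) (t : ℂ → ℂ) (ht : ∀ z ∈ S, t (conj z) = conj (t z)) :
    ∃ v : Fin n → ℝ, ∀ z ∈ S, ∑ i, v i • z ^ (i : ℕ) = t z := by
  set g := Lagrange.interpolate S id t
  have hg : ∀ z ∈ S, ∑ i : Fin n, g.coeff i * z ^ (i : ℕ) = t z := by
    intro z hz
    rw [← Lagrange.eval_interpolate_at_node t (Function.injective_id.injOn (s := (S : Set ℂ))) hz]
    have hd : g.degree < n := (Lagrange.degree_interpolate_lt t
      Function.injective_id.injOn).trans_le (by exact_mod_cast hn)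
    change _ = g.eval z
    rw [eval_eq_sum, ← sum_fin _ (by simp) hd]
  refine ⟨fun i => (g.coeff i).re, fun z hz => ?_⟩
  have h1 := hg z hz
  have h2 := congrArg conj (hg _ (hS z hz))
  rw [ht z hz] at h2
  simp only [map_sum, map_mul, map_pow, Complex.conj_conj] at h2
  have h3 : ∀ i : Fin n, (g.coeff i).re • z ^ (i : ℕ) =
      (g.coeff i * z ^ (i : ℕ) + conj (g.coeff i) * z ^ (i : ℕ)) / 2 := by
    intro i
    rw [← add_mul, Complex.add_conj, Complex.real_smul]
    push_cast
    ring
  simp_rw [h3]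
  rw [← Finset.sum_div, Finset.sum_add_distrib, h1, h2]
  ring

/-- Coordinates on real polynomials of degree `< n`: the real part of the value at each node in
the closed upper half plane, and the imaginary part at each node in the open lower one. -/
noncomputable def realCoords (S : Finset ℂ) (n : ℕ) : (Fin n → ℝ) →ₗ[ℝ] S → ℝ :=
  LinearMap.pi fun z => (if 0 ≤ (z : ℂ).im then Complex.reLm else Complex.imLm) ∘ₗ
    Fintype.linearCombination ℝ fun i : Fin n => (z : ℂ) ^ (i : ℕ)

theorem realCoords_apply (S : Finset ℂ) (n : ℕ) (v : Fin n → ℝ) (z : S) :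
    realCoords S n v z = if 0 ≤ (z : ℂ).im then (∑ i, v i • (z : ℂ) ^ (i : ℕ)).re
      else (∑ i, v i • (z : ℂ) ^ (i : ℕ)).im := by
  unfold realCoords
  split_ifs with h <;> simp [h, Fintype.linearCombination_apply]

theorem realCoords_surjective (S : Finset ℂ) (n : ℕ) (hn : S.card ≤ n)
    (hS : ∀ z ∈ S, conj z ∈ S) : Function.Surjective (realCoords S n) := by
  intro y
  let Y : ℂ → ℝ := fun z => if h : z ∈ S then y ⟨z, h⟩ else 0
  let t : ℂ → ℂ := fun z => if z.im = 0 then (Y z : ℂ) else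
    if 0 < z.im then ⟨Y z, -Y (conj z)⟩ else ⟨Y (conj z), Y z⟩
  have ht : ∀ z, t (conj z) = conj (t z) := by
    intro z
    rcases lt_trichotomy z.im 0 with h | h | h
    · simp [t, h, h.ne, h.not_gt, Complex.ext_iff]
    · have : conj z = z := Complex.conj_eq_iff_im.2 h
      simp [t, h, this]
    · simp [t, h, h.ne', h.not_gt, Complex.ext_iff]
  obtain ⟨v, hv⟩ := exists_real_coeff_interpolation S n hn hS t fun z _ => ht z
  refine ⟨v, funext fun z => ?_⟩
  rw [realCoords_apply, hv z z.2]
  have hY : Y z = y z := by simp [Y]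
  rcases lt_trichotomy (z : ℂ).im 0 with h | h | h
  · simp [t, h.ne, h.not_gt, h.not_ge, hY]
  · simp [t, h, hY]
  · simp [t, h, h.ne', h.le, hY]

/-- The weight attached to a node: `1` on the real line, `2` above it and
`-2` below it. -/
noncomputable def halfPlaneWeight (z : ℂ) : ℝ :=
  if z.im = 0 then 1 else if 0 < z.im then 2 else -2

theorem sum_halfPlaneWeight_mul_realCoords_sq (S : Finset ℂ) (n : ℕ)
    (hS : ∀ z ∈ S, conj z ∈ S) (m : ℂ → ℝ) (hm : ∀ z, m (conj z) = m z) (v : Fin n → ℝ) :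
    ∑ z : S, m z * halfPlaneWeight z * realCoords S n v z ^ 2 =
      ∑ z ∈ S, m z * ((∑ i, v i • z ^ (i : ℕ)) ^ 2).re := by
  set F : ℂ → ℂ := fun z => ∑ i, v i • z ^ (i : ℕ)
  have hF : ∀ z, F (conj z) = conj (F z) := fun z => by simp [F]
  let c : ℂ → ℝ := fun z =>
    m z * halfPlaneWeight z * (if 0 ≤ z.im then (F z).re else (F z).im) ^ 2
  have hc : ∑ z : S, m z * halfPlaneWeight z * realCoords S n v z ^ 2 = ∑ z ∈ S, c z := by
    rw [← Finset.sum_coe_sort S]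
    simp only [realCoords_apply, c, F]
  have hsym : ∑ z ∈ S, c (conj z) = ∑ z ∈ S, c z :=
    Finset.sum_nbij' (fun z => conj z) (fun z => conj z) hS hS (by simp) (by simp) (by simp)
  have hpair : ∀ z, c z + c (conj z) = 2 * (m z * (F z ^ 2).re) := by
    intro z
    simp only [c, hF, hm, halfPlaneWeight, sq, Complex.mul_re]
    rcases lt_trichotomy z.im 0 with h | h | h
    · simp [h, h.ne, h.not_gt, h.not_ge, h.le]
      ring
    · have : (F z).im = 0 := by
        rw [← Complex.conj_eq_iff_im, ← hF, Complex.conj_eq_iff_im.2 h]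
      simp [h, this]
      ring
    · simp [h, h.ne', h.not_gt, h.not_ge, h.le]
      ring
  have := Finset.sum_congr rfl fun z (_ : z ∈ S) => hpair z
  rw [Finset.sum_add_distrib, hsym, ← Finset.mul_sum] at this
  rw [hc]
  linarith

theorem roots_map_conj (P : ℝ[X]) :
    (P.map (algebraMap ℝ ℂ)).roots.map conj = (P.map (algebraMap ℝ ℂ)).roots := by
  rw [← (IsAlgClosed.splits (P.map (algebraMap ℝ ℂ))).roots_map (starRingEnd ℂ), map_map]
  congr 2
  ext x
  simp

/-- The signed count of the weights over a conjugation-stable set is its number of real points. -/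
theorem card_pos_sub_card_neg_halfPlaneWeight (S : Finset ℂ) (hS : ∀ z ∈ S, conj z ∈ S)
    (m : ℂ → ℝ) (hm : ∀ z ∈ S, 0 < m z) :
    ((Finset.univ.filter fun z : S => 0 < m z * halfPlaneWeight z).card : ℤ) -
      ((Finset.univ.filter fun z : S => m z * halfPlaneWeight z < 0).card : ℤ) =
      ((S.filter fun z => z.im = 0).card : ℤ) := by
  have hsub : ∀ q : ℂ → Prop, ∀ [DecidablePred q],
      (Finset.univ.filter fun z : S => q z).card = (S.filter q).card := by
    intro q _
    simp only [Finset.card_filter]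
    exact Finset.sum_coe_sort S fun z => if q z then 1 else 0
  have hpos : (Finset.univ.filter fun z : S => 0 < m z * halfPlaneWeight z).card =
      (S.filter fun z => 0 ≤ z.im).card := by
    rw [hsub fun z => 0 < m z * halfPlaneWeight z]
    refine congrArg _ (Finset.filter_congr fun z hz => ?_)
    rw [mul_pos_iff_of_pos_left (hm z hz), halfPlaneWeight]
    rcases lt_trichotomy z.im 0 with h | h | h
    · simp [h.ne, h.not_gt, h.not_ge]
    · simp [h]
    · simp [h, h.ne', h.le]
  have hneg : (Finset.univ.filter fun z : S => m z * halfPlaneWeight z < 0).card =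
      (S.filter fun z => z.im < 0).card := by
    rw [hsub fun z => m z * halfPlaneWeight z < 0]
    refine congrArg _ (Finset.filter_congr fun z hz => ?_)
    rw [← smul_eq_mul, smul_neg_iff_of_pos_left (hm z hz), halfPlaneWeight]
    rcases lt_trichotomy z.im 0 with h | h | h
    · simp [h, h.ne, h.not_gt]
    · simp [h]
    · simp [h, h.ne', h.not_gt]
  have hconj : (S.filter fun z => z.im < 0).card = (S.filter fun z => 0 < z.im).card :=
    Finset.card_nbij' (fun z => conj z) (fun z => conj z)
      (fun z hz => by simp_all) (fun z hz => by simp_all) (fun z _ => Complex.conj_conj z)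
      (fun z _ => Complex.conj_conj z)
  have hsplit : (S.filter fun z => 0 ≤ z.im).card =
      (S.filter fun z => 0 < z.im).card + (S.filter fun z => z.im = 0).card := by
    rw [← Finset.card_union_of_disjoint]
    · congr 1
      ext z
      simp [le_iff_lt_or_eq, eq_comm, and_or_left]
    · refine Finset.disjoint_filter.2 fun z _ h h' => h.ne' h'
  rw [hpos, hneg, hconj, hsplit]
  push_cast
  ring

theorem card_filter_im_eq_zero_roots (P : ℝ[X]) (hP : P ≠ 0) :
    ((P.map (algebraMap ℝ ℂ)).roots.toFinset.filter fun z => z.im = 0).card =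
      P.roots.toFinset.card := by
  rw [← Finset.card_image_of_injective P.roots.toFinset Complex.ofReal_injective]
  congr 1
  have hP' : P.map (algebraMap ℝ ℂ) ≠ 0 := Polynomial.map_ne_zero hP
  have hroot : ∀ x : ℝ, (P.map (algebraMap ℝ ℂ)).IsRoot (x : ℂ) ↔ P.IsRoot x := fun x =>
    isRoot_map_iff (algebraMap ℝ ℂ).injective
  ext z
  simp only [Finset.mem_filter, Multiset.mem_toFinset, Finset.mem_image, mem_roots hP,
    mem_roots hP']
  constructor
  · rintro ⟨hz, h0⟩
    have hzre : ((z.re : ℝ) : ℂ) = z := Complex.ext (by simp) (by simp [h0])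
    exact ⟨z.re, (hroot _).1 (hzre.symm ▸ hz), hzre⟩
  · rintro ⟨x, hx, rfl⟩
    exact ⟨(hroot x).2 hx, Complex.ofReal_im x⟩

/-- Hermite–Sylvester: the number of distinct real roots of a monic real polynomial of
degree `s ≥ 1` equals the signature of the `s × s` Hankel matrix of Newton power sums of
its complex roots. -/
theorem hermite_sylvester (s : ℕ) (hs : 1 ≤ s) (P : Polynomial ℝ) (hm : P.Monic)
    (hdeg : P.natDegree = s)
    (p : ℕ → ℂ)
    (hp : ∀ k, p k = ((P.map (algebraMap ℝ ℂ)).roots.map (· ^ k)).sum)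
    (H : Matrix (Fin s) (Fin s) ℝ)
    (hH : ∀ i j : Fin s, H i j = (p ((i : ℕ) + (j : ℕ))).re) :
    (∀ k, (p k).im = 0) ∧
    ∃ herm : H.IsHermitian,
      ((Finset.univ.filter fun i => 0 < herm.eigenvalues i).card : ℤ) -
        ((Finset.univ.filter fun i => herm.eigenvalues i < 0).card : ℤ) =
      (P.roots.toFinset.card : ℤ) := by
  have hconj := roots_map_conj P
  have hcardim := card_filter_im_eq_zero_roots P hm.ne_zero
  have hdegC : (P.map (algebraMap ℝ ℂ)).natDegree = s := by rw [natDegree_map, hdeg]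
  have hcard : (P.map (algebraMap ℝ ℂ)).roots.toFinset.card ≤ s :=
    (Multiset.toFinset_card_le _).trans (hdegC ▸ card_roots' _)
  set R := (P.map (algebraMap ℝ ℂ)).roots
  have hcount : ∀ z, R.count (conj z) = R.count z := fun z => by
    conv_lhs => rw [← hconj]
    exact Multiset.count_map_eq_count' _ _ (starRingEnd ℂ).injective z
  have hS : ∀ z ∈ R.toFinset, conj z ∈ R.toFinset := fun z hz => by
    rw [Multiset.mem_toFinset, ← Multiset.count_pos] at hz ⊢
    rwa [hcount]
  have herm : H.IsHermitian := by
    ext i j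
    simp [hH, add_comm]
  refine ⟨fun k => ?_, herm, ?_⟩
  · rw [← Complex.conj_eq_iff_im, hp, map_multiset_sum, Multiset.map_map]
    conv_rhs => rw [← hconj, Multiset.map_map]
    simp
  have hform : ∀ v : Fin s → ℝ, v ⬝ᵥ (H.mulVec v) =
      ∑ z ∈ R.toFinset, (R.count z : ℝ) * ((∑ i, v i • z ^ (i : ℕ)) ^ 2).re := by
    intro v
    have hHij : ∀ i j : Fin s, H i j =
        ∑ z ∈ R.toFinset, (R.count z : ℝ) * (z ^ (i : ℕ) * z ^ (j : ℕ)).re := by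
      intro i j
      rw [hH, hp, Finset.sum_multiset_map_count, Complex.re_sum]
      simp [pow_add]
    have hsq : ∀ z : ℂ, ((∑ i, v i • z ^ (i : ℕ)) ^ 2).re =
        ∑ i, ∑ j, v i * (v j * (z ^ (i : ℕ) * z ^ (j : ℕ)).re) := by
      intro z
      rw [sq, Finset.sum_mul_sum, Complex.re_sum]
      simp_rw [Complex.re_sum, smul_mul_smul_comm, Complex.smul_re, smul_eq_mul, mul_assoc]
    simp_rw [dotProduct, Matrix.mulVec, dotProduct, hHij, hsq, Finset.mul_sum, Finset.sum_mul]
    rw [Finset.sum_comm]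
    simp_rw [Finset.sum_comm (s := R.toFinset)]
    rw [Finset.sum_comm]
    refine Finset.sum_congr rfl fun i _ => Finset.sum_congr rfl fun j _ => ?_
    rw [Finset.mul_sum]
    exact Finset.sum_congr rfl fun z _ => by ring
  obtain ⟨f, hf, hfv⟩ := herm.exists_surjective_sum_eigenvalues
  have hg := realCoords_surjective R.toFinset s hcard hS
  have heq : ∀ v, ∑ i, herm.eigenvalues i * f v i ^ 2 =
      ∑ z : R.toFinset, ((R.count (z : ℂ) : ℝ) * halfPlaneWeight z) *
        realCoords R.toFinset s v z ^ 2 := fun v => by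
    rw [hfv, hform, sum_halfPlaneWeight_mul_realCoords_sq R.toFinset s hS
      (fun z => (R.count z : ℝ)) (by simp [hcount])]
  rw [card_pos_weights_eq _ _ f _ hf hg heq, card_neg_weights_eq _ _ f _ hf hg heq, ← hcardim]
  exact card_pos_sub_card_neg_halfPlaneWeight _ hS (fun z => (R.count z : ℝ)) fun z hz => by
    exact_mod_cast Multiset.count_pos.2 (Multiset.mem_toFinset.1 hz)
end

section
/- Let P ∈ ℝ[z] be a monic polynomial of degree s ≥ 1 whose s complex roots r₁, …, r_s are pairwise distinct, and let Δ = ∏_{1 ≤ i < j ≤ s} (rᵢ − rⱼ)² be its discriminant. Then Δ is a nonzero real number, and the number of real roots of P is congruent to (s − 1) + sgn(Δ) modulo 4. -/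
open Polynomial

open scoped ComplexConjugate

lemma Equiv.Perm.card_and_sign_of_pow_two_eq_one {α : Type*} [Fintype α] [DecidableEq α]
    {σ : Equiv.Perm α} (hσ : σ ^ 2 = 1) :
    ∃ k, Fintype.card α = Fintype.card (Function.fixedPoints σ) + 2 * k ∧
      Equiv.Perm.sign σ = (-1) ^ k := by
  have hc := Equiv.Perm.card_fixedPoints σ
  have hle := Equiv.Perm.sum_cycleType_le σ
  have hsum : σ.cycleType.sum = σ.cycleType.card * 2 := by
    conv_lhs => rw [Equiv.Perm.cycleType_of_pow_prime_eq_one hσ]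
    simp
  refine ⟨σ.cycleType.card, by omega, ?_⟩
  rw [Equiv.Perm.sign_of_pow_two_eq_one hσ]
  congr 1
  omega

lemma conj_det_vandermonde {n : ℕ} {r : Fin n → ℂ} {σ : Equiv.Perm (Fin n)}
    (hσ : ∀ i, conj (r i) = r (σ i)) :
    conj (Matrix.vandermonde r).det
      = ((Equiv.Perm.sign σ : ℤ) : ℂ) * (Matrix.vandermonde r).det := by
  rw [← Matrix.det_permute, RingHom.map_det]
  congr 1
  ext i j
  simp [Matrix.vandermonde_apply, hσ]

lemma prod_sub_sq_eq_det_vandermonde_sq {R : Type*} [CommRing R] {n : ℕ} (r : Fin n → R) :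
    ∏ i : Fin n, ∏ j ∈ Finset.univ.filter (fun j => i < j), (r i - r j) ^ 2
      = (Matrix.vandermonde r).det ^ 2 := by
  simp only [Matrix.det_vandermonde, ← Finset.prod_pow]
  refine Finset.prod_congr rfl fun i _ => Finset.prod_congr (by ext; simp) fun j _ => ?_
  ring

/-- The action of complex conjugation on the indices of a closed family of distinct numbers. -/
lemma exists_perm_conj {ι : Type*} {r : ι → ℂ} (hr : Function.Injective r)
    (hconj : ∀ i, ∃ j, r j = conj (r i)) :
    ∃ σ : Equiv.Perm ι, σ ^ 2 = 1 ∧ ∀ i, conj (r i) = r (σ i) := by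
  choose f hf using hconj
  have hinv : Function.Involutive f := fun i => hr (by rw [hf, hf, Complex.conj_conj])
  refine ⟨hinv.toPerm f, ?_, fun i => (hf i).symm⟩
  ext i
  simp [sq, hinv i]

lemma card_roots_eq_card_fixedPoints {ι : Type*} [Fintype ι] [DecidableEq ι] {P : ℝ[X]}
    {r : ι → ℂ} (hr : (P.map (algebraMap ℝ ℂ)).roots = Multiset.map r Finset.univ.val)
    (hinj : Function.Injective r) {σ : Equiv.Perm ι} (hσ : ∀ i, conj (r i) = r (σ i)) :
    P.roots.card = Fintype.card (Function.fixedPoints σ) := by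
  have hof : Function.Injective (algebraMap ℝ ℂ) := (algebraMap ℝ ℂ).injective
  have hnodup : (P.map (algebraMap ℝ ℂ)).roots.Nodup :=
    hr ▸ Finset.univ.nodup.map hinj
  have hP : P.roots.Nodup :=
    Multiset.Nodup.of_map _ (Multiset.nodup_of_le (map_roots_le_of_injective P hof) hnodup)
  have himage : P.roots.toFinset.image (algebraMap ℝ ℂ)
      = (Finset.univ.filter fun i => σ i = i).image r := by
    ext z
    have hmem : z ∈ (P.map (algebraMap ℝ ℂ)).roots ↔ ∃ i, r i = z := by simp [hr]
    simp only [Finset.mem_image, Multiset.mem_toFinset, Finset.mem_filter, Finset.mem_univ,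
      true_and]
    constructor
    · rintro ⟨x, hx, rfl⟩
      obtain ⟨i, hi⟩ := hmem.1
        (Multiset.mem_of_le (map_roots_le_of_injective P hof) (Multiset.mem_map_of_mem _ hx))
      refine ⟨i, hinj ?_, hi⟩
      rw [← hσ, hi]
      exact Complex.conj_ofReal x
    · rintro ⟨i, hi, rfl⟩
      obtain ⟨x, hx⟩ := Complex.conj_eq_iff_real.1 ((hσ i).trans (congrArg r hi))
      have hroot := mem_roots'.1 (hmem.2 ⟨i, rfl⟩)
      refine ⟨x, mem_roots'.2 ⟨fun h => hroot.1 (by simp [h]), ?_⟩, hx.symm⟩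
      have := hroot.2
      rw [hx] at this
      exact this.of_map hof
  rw [← Multiset.toFinset_card_of_nodup hP, ← Finset.card_image_of_injective _ hof, himage,
    Finset.card_image_of_injective _ hinj]
  exact (Fintype.card_of_subtype _ (by simp [Function.IsFixedPt])).symm

/-- For a monic real polynomial of degree `s ≥ 1` with pairwise distinct complex roots,
the discriminant `Δ = ∏_{i<j} (rᵢ - rⱼ)²` is a nonzero real number, and the number of
real roots is congruent to `(s - 1) + sgn Δ` modulo 4. -/
theorem card_real_roots_mod_four (s : ℕ) (hs : 1 ≤ s) (P : Polynomial ℝ) (hm : P.Monic)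
    (hdeg : P.natDegree = s)
    (r : Fin s → ℂ) (hr : (P.map (algebraMap ℝ ℂ)).roots = Multiset.map r Finset.univ.val)
    (hdist : Function.Injective r)
    (Δ : ℂ)
    (hΔ : Δ = ∏ i : Fin s, ∏ j ∈ Finset.univ.filter (fun j => i < j), (r i - r j) ^ 2) :
    Δ.im = 0 ∧ Δ ≠ 0 ∧
      (P.roots.card : ℤ) ≡ ((s : ℤ) - 1) + sgn Δ.re [ZMOD 4] := by
  have hconj : ∀ i, ∃ j, r j = conj (r i) := by
    have hmem : ∀ z, z ∈ (P.map (algebraMap ℝ ℂ)).roots ↔ ∃ i, r i = z := by simp [hr]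
    intro i
    have hi := (hmem _).2 ⟨i, rfl⟩
    rw [mem_roots_map hm.ne_zero, ← aeval_def] at hi
    rw [← hmem, mem_roots_map hm.ne_zero, ← aeval_def, aeval_conj, hi, map_zero]
  obtain ⟨σ, hσ2, hσ⟩ := exists_perm_conj hdist hconj
  obtain ⟨k, hk, hsign⟩ := Equiv.Perm.card_and_sign_of_pow_two_eq_one hσ2
  rw [Fintype.card_fin, ← card_roots_eq_card_fixedPoints hr hdist hσ] at hk
  have hV := conj_det_vandermonde hσ
  have hV0 : (Matrix.vandermonde r).det ≠ 0 := Matrix.det_vandermonde_ne_zero_iff.2 hdist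
  rw [prod_sub_sq_eq_det_vandermonde_sq] at hΔ
  rw [hsign] at hV
  generalize (Matrix.vandermonde r).det = V at hΔ hV hV0
  subst hΔ
  have hne : V ^ 2 ≠ 0 := pow_ne_zero 2 hV0
  rcases Nat.even_or_odd k with hpar | hpar
  · simp only [hpar.neg_one_pow, Units.val_one, Int.cast_one, one_mul] at hV
    obtain ⟨x, rfl⟩ := Complex.conj_eq_iff_real.1 hV
    have hx : x ≠ 0 := by simpa using hV0
    have hre : ((x : ℂ) ^ 2).re = x ^ 2 := by norm_cast
    refine ⟨by norm_cast, hne, ?_⟩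
    rw [hre, sgn, if_pos (by positivity), Int.ModEq]
    obtain ⟨m, rfl⟩ := hpar
    omega
  · simp only [hpar.neg_one_pow, Units.val_neg, Units.val_one, Int.cast_neg, Int.cast_one,
      neg_mul, one_mul] at hV
    have hre0 : V.re = 0 := by
      have := congrArg Complex.re hV
      simp only [Complex.conj_re, Complex.neg_re] at this
      linarith
    have him : V.im ≠ 0 := fun h => hV0 (Complex.ext hre0 h)
    have hre : (V ^ 2).re = -V.im ^ 2 := by simp [sq, hre0]
    have hneg : -V.im ^ 2 < 0 := neg_neg_of_pos (by positivity)
    refine ⟨by simp [sq, hre0], hne, ?_⟩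
    rw [hre, sgn, if_neg hneg.not_gt, if_pos hneg, Int.ModEq]
    obtain ⟨m, rfl⟩ := hpar
    omega
end

section
/- Let Z ⊆ ℝⁿ be a real algebraic set and let A be a connected component of Z. Then A is arc-symmetric: for every ε > 0 and every real analytic map γ : (−ε, ε) → ℝⁿ such that γ(t) ∈ A for all t ∈ (−ε, 0), one has γ(t) ∈ Z for all t ∈ (−ε, ε), and in fact γ(t) ∈ A for all t ∈ (−ε, ε). -/
open MvPolynomial

/-- A connected component of a real algebraic set is arc-symmetric: any real analytic arc
`γ : (-ε, ε) → ℝⁿ` lying in the component `A` for negative times stays in the algebraic set,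
and indeed in `A`, for all times in `(-ε, ε)`. -/
theorem connectedComponent_arcSymmetric (n k : ℕ) (f : Fin k → MvPolynomial (Fin n) ℝ)
    (Z : Set (Fin n → ℝ)) (hZ : Z = {x | ∀ i, eval x (f i) = 0})
    (x₀ : Fin n → ℝ) (hx₀ : x₀ ∈ Z)
    (A : Set (Fin n → ℝ)) (hA : A = connectedComponentIn Z x₀)
    (ε : ℝ) (hε : 0 < ε) (γ : ℝ → (Fin n → ℝ))
    (hγan : AnalyticOnNhd ℝ γ (Set.Ioo (-ε) ε))
    (hγA : ∀ t ∈ Set.Ioo (-ε) (0 : ℝ), γ t ∈ A) :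
    ∀ t ∈ Set.Ioo (-ε) ε, γ t ∈ Z ∧ γ t ∈ A := by
  have hIoo : IsPreconnected (Set.Ioo (-ε) ε) := isPreconnected_Ioo
  have hmid : -ε / 2 ∈ Set.Ioo (-ε) (0 : ℝ) := ⟨by linarith, by linarith⟩
  have hmid' : -ε / 2 ∈ Set.Ioo (-ε) ε := ⟨hmid.1, hmid.2.trans hε⟩
  have hAZ : A ⊆ Z := hA ▸ connectedComponentIn_subset Z x₀
  have hγZ : ∀ t ∈ Set.Ioo (-ε) ε, γ t ∈ Z := by
    intro t ht
    rw [hZ]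
    intro i
    have han : AnalyticOnNhd ℝ (fun s ↦ aeval (γ s) (f i)) (Set.Ioo (-ε) ε) :=
      AnalyticOnNhd.aeval_mvPolynomial
        (fun j s hs ↦ (ContinuousLinearMap.proj (R := ℝ) j).analyticAt (γ s) |>.comp (hγan s hs))
        (f i)
    have hzero : (fun s ↦ aeval (γ s) (f i)) =ᶠ[nhds (-ε / 2)] (0 : ℝ → ℝ) := by
      filter_upwards [Ioo_mem_nhds hmid.1 hmid.2] with s hs
      have hs' : γ s ∈ {x | ∀ i, eval x (f i) = 0} := hZ ▸ hAZ (hγA s hs)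
      simpa [aeval_eq_eval] using hs' i
    simpa [aeval_eq_eval] using han.eqOn_zero_of_preconnected_of_eventuallyEq_zero
      hIoo hmid' hzero ht
  intro t ht
  refine ⟨hγZ t ht, ?_⟩
  have hmidA : γ (-ε / 2) ∈ connectedComponentIn Z x₀ := hA ▸ hγA _ hmid
  rw [hA, connectedComponentIn_eq hmidA]
  exact (hIoo.image γ hγan.continuousOn).subset_connectedComponentIn
    (Set.mem_image_of_mem γ hmid') (Set.image_subset_iff.mpr hγZ) (Set.mem_image_of_mem γ ht)
end

section
/- Let X ⊆ ℝⁿ be a real algebraic set. Then the one-point compactification X ∪ {∞} of X is homeomorphic to a real algebraic set: there exist m ∈ ℕ and a real algebraic set Y ⊆ ℝᵐ such that the one-point compactification of X is homeomorphic to Y. -/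
open MvPolynomial

/-- Up to a positive power of the extra variable, the homogenization of `p`. -/
theorem MvPolynomial.exists_eval_cons_smul_eq {n : ℕ} (p : MvPolynomial (Fin n) ℝ) :
    ∃ (q : MvPolynomial (Fin (n + 1)) ℝ) (N : ℕ), ∀ (t : ℝ) (x : Fin n → ℝ),
      eval (Fin.cons t (t • x) : Fin (n + 1) → ℝ) q = t ^ (N + 1) * eval x p := by
  induction p using MvPolynomial.induction_on with
  | C a => exact ⟨X 0 * C a, 0, fun t x => by simp⟩
  | add p₁ p₂ h₁ h₂ =>
    obtain ⟨q₁, N₁, h₁⟩ := h₁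
    obtain ⟨q₂, N₂, h₂⟩ := h₂
    refine ⟨X 0 ^ N₂ * q₁ + X 0 ^ N₁ * q₂, N₁ + N₂, fun t x => ?_⟩
    simp only [map_add, map_mul, map_pow, eval_X, h₁, h₂, Fin.cons_zero]
    ring
  | mul_X p i h =>
    obtain ⟨q, N, h⟩ := h
    refine ⟨q * X i.succ, N + 1, fun t x => ?_⟩
    simp only [map_mul, eval_X, h, Fin.cons_succ, Pi.smul_apply, smul_eq_mul]
    ring

/-- The inversion in the unit sphere of `ℝⁿ⁺¹` restricted to the hyperplane where the first
coordinate is `1`. -/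
noncomputable def hyperplaneInversion {n : ℕ} (x : Fin n → ℝ) : Fin (n + 1) → ℝ :=
  Fin.cons (1 + ∑ i, x i ^ 2)⁻¹ ((1 + ∑ i, x i ^ 2)⁻¹ • x)

theorem one_add_sum_sq_pos {n : ℕ} (x : Fin n → ℝ) : 0 < 1 + ∑ i, x i ^ 2 := by positivity

theorem continuous_hyperplaneInversion {n : ℕ} :
    Continuous (hyperplaneInversion : (Fin n → ℝ) → Fin (n + 1) → ℝ) := by
  have h : Continuous fun x : Fin n → ℝ => (1 + ∑ i, x i ^ 2)⁻¹ :=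
    Continuous.inv₀ (by fun_prop) fun x => (one_add_sum_sq_pos x).ne'
  refine continuous_pi fun j => ?_
  cases j using Fin.cases with
  | zero => simpa [hyperplaneInversion] using h
  | succ i => exact h.mul (continuous_apply i)

theorem hyperplaneInversion_zero_ne_zero {n : ℕ} (x : Fin n → ℝ) :
    hyperplaneInversion x 0 ≠ 0 := by
  simpa [hyperplaneInversion] using (one_add_sum_sq_pos x).ne'

theorem hyperplaneInversion_injective {n : ℕ} :
    Function.Injective (hyperplaneInversion : (Fin n → ℝ) → Fin (n + 1) → ℝ) := by
  intro x y h
  obtain ⟨h₀, h₁⟩ := Fin.cons_injective2 h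
  rw [← h₀] at h₁
  exact smul_right_injective _ (inv_ne_zero (one_add_sum_sq_pos x).ne') h₁

theorem sum_sq_hyperplaneInversion {n : ℕ} (x : Fin n → ℝ) :
    ∑ j, hyperplaneInversion x j ^ 2 = hyperplaneInversion x 0 := by
  have h := (one_add_sum_sq_pos x).ne'
  simp only [hyperplaneInversion, Fin.sum_univ_succ, Fin.cons_zero, Fin.cons_succ, Pi.smul_apply,
    smul_eq_mul, mul_pow, ← Finset.mul_sum]
  field_simp

theorem exists_hyperplaneInversion_eq {n : ℕ} {z : Fin (n + 1) → ℝ} (hz : ∑ j, z j ^ 2 = z 0)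
    (h₀ : z 0 ≠ 0) : ∃ x, hyperplaneInversion x = z := by
  refine ⟨(z 0)⁻¹ • Fin.tail z, ?_⟩
  have h : (1 + ∑ i, ((z 0)⁻¹ • Fin.tail z) i ^ 2)⁻¹ = z 0 := by
    simp only [Pi.smul_apply, smul_eq_mul, mul_pow, ← Finset.mul_sum, Fin.tail]
    rw [Fin.sum_univ_succ] at hz
    rw [eq_sub_of_add_eq' hz]
    field_simp
    simp
  rw [hyperplaneInversion, h, smul_inv_smul₀ h₀, Fin.cons_self_tail]

theorem tendsto_hyperplaneInversion_cocompact {n : ℕ} :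
    Filter.Tendsto (hyperplaneInversion : (Fin n → ℝ) → Fin (n + 1) → ℝ)
      (Filter.cocompact _) (nhds 0) := by
  have hS : Filter.Tendsto (fun x : Fin n → ℝ => 1 + ∑ i, x i ^ 2) (Filter.cocompact _)
      Filter.atTop := by
    refine Filter.tendsto_atTop_mono (fun x => ?_) (tendsto_norm_cocompact_atTop (E := Fin n → ℝ))
    refine (pi_norm_le_iff_of_nonneg (one_add_sum_sq_pos x).le).2 fun i => ?_
    have hi : x i ^ 2 ≤ ∑ i, x i ^ 2 :=
      Finset.single_le_sum (f := fun i => x i ^ 2) (fun j _ => sq_nonneg _) (Finset.mem_univ i)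
    rw [Real.norm_eq_abs]
    nlinarith [sq_abs (x i), sq_nonneg (|x i| - 1)]
  have h₀ : Filter.Tendsto (fun x : Fin n → ℝ => hyperplaneInversion x 0) (Filter.cocompact _)
      (nhds 0) := by
    exact hS.inv_tendsto_atTop
  refine tendsto_pi_nhds.2 fun j => ?_
  rw [Pi.zero_apply]
  refine squeeze_zero_norm (fun x => ?_) (by simpa using h₀.sqrt)
  rw [Real.norm_eq_abs, ← sum_sq_hyperplaneInversion]
  exact Real.abs_le_sqrt (Finset.single_le_sum (f := fun j => hyperplaneInversion x j ^ 2)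
    (fun j _ => sq_nonneg _) (Finset.mem_univ j))

/-- A closed subset of `ℝⁿ`, compactified by adding `0` to its image under
`hyperplaneInversion`. -/
theorem nonempty_onePoint_homeomorph_of_isClosed {n : ℕ} {X : Set (Fin n → ℝ)}
    (hX : IsClosed X) :
    Nonempty (OnePoint X ≃ₜ (insert 0 (hyperplaneInversion '' X) : Set (Fin (n + 1) → ℝ))) := by
  let φ : OnePoint X → Fin (n + 1) → ℝ := fun x => x.elim 0 fun x => hyperplaneInversion x
  have hφ : Continuous φ := by
    refine (OnePoint.continuous_iff φ).2 ⟨?_, ?_⟩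
    · rw [Filter.coclosedCompact_eq_cocompact]
      exact tendsto_hyperplaneInversion_cocompact.comp
        hX.isClosedEmbedding_subtypeVal.tendsto_cocompact
    · exact continuous_hyperplaneInversion.comp continuous_subtype_val
  have hne (x : X) : hyperplaneInversion (x : Fin n → ℝ) ≠ 0 := fun h =>
    hyperplaneInversion_zero_ne_zero x.1 (congrFun h 0)
  have hinj : Function.Injective φ := by
    intro x y h
    induction x using OnePoint.rec with
    | infty =>
      induction y using OnePoint.rec with
      | infty => rfl
      | coe y => exact (hne y h.symm).elim
    | coe x =>
      induction y using OnePoint.rec with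
      | infty => exact (hne x h).elim
      | coe y => exact congrArg _ (Subtype.ext (hyperplaneInversion_injective h))
  have hrange : Set.range φ = insert 0 (hyperplaneInversion '' X) := by
    ext z
    simp [φ, OnePoint.exists, eq_comm]
  exact ⟨(hφ.isClosedEmbedding hinj).isEmbedding.toHomeomorph.trans (Homeomorph.setCongr hrange)⟩

/-- The one-point compactification of a real algebraic set is homeomorphic to a real
algebraic set. -/
theorem onePoint_homeomorph_algebraic_set (n k : ℕ) (f : Fin k → MvPolynomial (Fin n) ℝ)
    (X : Set (Fin n → ℝ)) (hX : X = {x | ∀ i, eval x (f i) = 0}) :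
    ∃ (m l : ℕ) (g : Fin l → MvPolynomial (Fin m) ℝ),
      Nonempty (OnePoint X ≃ₜ {y : Fin m → ℝ | ∀ i, eval y (g i) = 0}) := by
  choose q N hq using fun i => (f i).exists_eval_cons_smul_eq
  let g : Fin (k + 1) → MvPolynomial (Fin (n + 1)) ℝ :=
    Fin.cons (∑ j, MvPolynomial.X j ^ 2 - MvPolynomial.X 0) q
  have hclosed : IsClosed X := by
    rw [hX, Set.ofPred_forall]
    exact isClosed_iInter fun i => isClosed_eq (MvPolynomial.continuous_eval _) continuous_const
  have hmem (x : Fin n → ℝ) : (∀ i, eval (hyperplaneInversion x) (q i) = 0) ↔ x ∈ X := by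
    simp [hX, hyperplaneInversion, hq, (one_add_sum_sq_pos x).ne']
  have hzero (i : Fin k) : eval 0 (q i) = 0 := by
    have h := hq i 0 0
    rwa [zero_smul, zero_pow (Nat.succ_ne_zero _), zero_mul, ← Matrix.vecCons,
      Matrix.cons_zero_zero] at h
  have hset : insert 0 (hyperplaneInversion '' X) =
      {y : Fin (n + 1) → ℝ | ∀ i, eval y (g i) = 0} := by
    ext z
    simp only [g, Fin.forall_fin_succ (n := k), Fin.cons_zero, Fin.cons_succ, map_sub, map_sum,
      map_pow, eval_X, sub_eq_zero, Set.mem_insert_iff, Set.mem_image, Set.mem_ofPred_eq]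
    constructor
    · rintro (rfl | ⟨x, hx, rfl⟩)
      · exact ⟨by simp, hzero⟩
      · exact ⟨sum_sq_hyperplaneInversion x, (hmem x).2 hx⟩
    · rintro ⟨hz, hqz⟩
      by_cases h₀ : z 0 = 0
      · rw [h₀, Finset.sum_eq_zero_iff_of_nonneg fun j _ => sq_nonneg (z j)] at hz
        exact Or.inl (funext fun j => pow_eq_zero_iff two_ne_zero |>.1 (hz j (Finset.mem_univ j)))
      · obtain ⟨x, rfl⟩ := exists_hyperplaneInversion_eq hz h₀
        exact Or.inr ⟨x, (hmem x).1 hqz, rfl⟩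
  obtain ⟨e⟩ := nonempty_onePoint_homeomorph_of_isClosed hclosed
  exact ⟨n + 1, k + 1, g, ⟨e.trans (Homeomorph.setCongr hset)⟩⟩
end

section
/- Let Q = {(x, y) ∈ ℝ² : x ≥ 0 and y ≥ 0} be the closed first quadrant. Then the function 2·𝟏_Q : ℝ² → ℤ is not a finite sum of signs of real polynomials: there do not exist polynomials g₁, …, g_s ∈ ℝ[x, y] with Σᵢ₌₁ˢ sgn(gᵢ(p)) = 2·𝟏_Q(p) for all p ∈ ℝ². Equivalently, 2·𝟏_Q is not an algebraically constructible function on ℝ². -/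
open MvPolynomial

theorem sgn_eq_one_or_neg_one {a : ℝ} (ha : a ≠ 0) : sgn a = 1 ∨ sgn a = -1 := by
  rcases ha.lt_or_gt with h | h
  · exact .inr (by simp [sgn, h, h.not_gt])
  · exact .inl (by simp [sgn, h])

theorem sgn_neg_one_pow (k : ℕ) : sgn ((-1) ^ k) = (-1) ^ k := by
  rcases neg_one_pow_eq_or ℝ k with h | h <;> rcases Nat.even_or_odd k with hk | hk <;>
    norm_num [sgn, hk.neg_one_pow]

/-- Modulo four, a sum of signs of nonzero reals is determined by the number of terms and the
sign of the product. -/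
theorem four_dvd_sum_sgn_sub {ι : Type*} (S : Finset ι) (f : ι → ℝ) (hf : ∀ i ∈ S, f i ≠ 0) :
    (4 : ℤ) ∣ ∑ i ∈ S, sgn (f i) - (S.card - 1 + sgn (∏ i ∈ S, f i)) := by
  classical
  induction S using Finset.induction_on with
  | empty => simp [sgn]
  | insert i S hi ih =>
    have hS : ∀ j ∈ S, f j ≠ 0 := fun j hj => hf j (Finset.mem_insert_of_mem hj)
    have hd := ih hS
    rw [Finset.sum_insert hi, Finset.prod_insert hi, Finset.card_insert_of_notMem hi, sgn_mul]
    push_cast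
    rcases sgn_eq_one_or_neg_one (hf i (Finset.mem_insert_self i S)) with h | h <;>
      rcases sgn_eq_one_or_neg_one (Finset.prod_ne_zero_iff.2 hS) with h' | h' <;>
      rw [h'] at hd <;> rw [h, h'] <;> omega

/-- Across the line `y = 0`, a nonzero real polynomial in two variables changes sign either at
almost every point of the line or at almost none, according to the parity of its order of
vanishing along the line. -/
theorem exists_sgn_evalEval_neg_eq (H : Polynomial (Polynomial ℝ)) (hH : H ≠ 0) :
    ∃ (c : Polynomial ℝ) (k : ℕ), c ≠ 0 ∧ ∀ x, c.eval x ≠ 0 → ∃ δ > 0,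
      H.evalEval x δ ≠ 0 ∧ H.evalEval x (-δ) ≠ 0 ∧
        sgn (H.evalEval x (-δ)) = (-1) ^ k * sgn (H.evalEval x δ) := by
  obtain ⟨K, hK, hdvd⟩ := Polynomial.exists_eq_pow_rootMultiplicity_mul_and_not_dvd H hH 0
  generalize Polynomial.rootMultiplicity 0 H = k at hK
  rw [map_zero, sub_zero] at hK hdvd
  rw [Polynomial.X_dvd_iff] at hdvd
  refine ⟨K.coeff 0, k, hdvd, fun x hx => ?_⟩
  have heval (y : ℝ) : H.evalEval x y = y ^ k * K.evalEval x y := by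
    rw [hK]; simp
  have hK0 : K.evalEval x 0 ≠ 0 := by
    simpa [Polynomial.evalEval, Polynomial.coeff_zero_eq_eval_zero] using hx
  have hcont : Continuous fun y : ℝ => K.evalEval x y := by
    simp only [← Polynomial.map_evalRingHom_eval]
    exact Polynomial.continuous _
  have hprod : ∀ᶠ y in nhds (0 : ℝ), 0 < K.evalEval x 0 * K.evalEval x y :=
    (continuous_const.mul hcont).continuousAt.eventually_const_lt (mul_self_pos.2 hK0)
  obtain ⟨ε, hε, hball⟩ := Metric.eventually_nhds_iff.1 hprod
  have hpos := hball (y := ε / 2) (by simp [abs_of_pos hε, hε])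
  have hneg := hball (y := -(ε / 2)) (by simp [abs_of_pos hε, hε])
  have hsgn : sgn (K.evalEval x (-(ε / 2))) = sgn (K.evalEval x (ε / 2)) := by
    rcases pos_and_pos_or_neg_and_neg_of_mul_pos hpos with h | h <;>
      rcases pos_and_pos_or_neg_and_neg_of_mul_pos hneg with h' | h' <;>
      simp [sgn, h.2, h'.2, h.2.not_gt, h'.2.not_gt] <;> linarith [h.1, h'.1]
  have hδ : ε / 2 ≠ 0 := by positivity
  refine ⟨ε / 2, by positivity, ?_, ?_, ?_⟩
  · rw [heval]
    exact mul_ne_zero (pow_ne_zero _ hδ) (right_ne_zero_of_mul hpos.ne')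
  · rw [heval]
    exact mul_ne_zero (pow_ne_zero _ (neg_ne_zero.2 hδ)) (right_ne_zero_of_mul hneg.ne')
  · rw [heval, heval, neg_pow, mul_assoc, sgn_mul, sgn_neg_one_pow, sgn_mul, sgn_mul, hsgn]

theorem exists_mem_eval_ne_zero {c : Polynomial ℝ} (hc : c ≠ 0) {s : Set ℝ} (hs : s.Infinite) :
    ∃ x ∈ s, c.eval x ≠ 0 := by
  by_contra! h
  exact hc (Polynomial.eq_zero_of_infinite_isRoot c (hs.mono h))

theorem evalEval_aeval_eq_eval (p : MvPolynomial (Fin 2) ℝ) (a b : ℝ) :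
    (aeval ![Polynomial.C Polynomial.X, Polynomial.X] p : Polynomial (Polynomial ℝ)).evalEval a b
      = eval ![a, b] p := by
  induction p using MvPolynomial.induction_on with
  | C r => simp [Polynomial.algebraMap_apply, Polynomial.evalEval]
  | add p q hp hq => simp [hp, hq]
  | mul_X p i hp =>
    rw [map_mul, Polynomial.evalEval_mul, hp, map_mul]
    fin_cases i <;> simp [Polynomial.evalEval]

/-- Twice the characteristic function of the closed first quadrant `Q ⊆ ℝ²` is not a finite
sum of signs of real polynomials (i.e. it is not algebraically constructible). -/
theorem two_mul_indicator_quadrant_not_sum_of_signs :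
    ¬ ∃ (s : ℕ) (g : Fin s → MvPolynomial (Fin 2) ℝ),
        ∀ x : Fin 2 → ℝ,
          (∑ i : Fin s, sgn (eval x (g i))) =
            (if 0 ≤ x 0 ∧ 0 ≤ x 1 then 2 else 0) := by
  classical
  rintro ⟨s, g, hg⟩
  let G (i : Fin s) : Polynomial (Polynomial ℝ) :=
    aeval ![Polynomial.C Polynomial.X, Polynomial.X] (g i)
  let S : Finset (Fin s) := {i | G i ≠ 0}
  let H := ∏ i ∈ S, G i
  have hH : H ≠ 0 := Finset.prod_ne_zero_iff.2 fun i hi => (Finset.mem_filter.1 hi).2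
  have hmod (a b : ℝ) (hab : H.evalEval a b ≠ 0) :
      (4 : ℤ) ∣ (if 0 ≤ a ∧ 0 ≤ b then 2 else 0) - (S.card - 1 + sgn (H.evalEval a b)) := by
    have hHab : H.evalEval a b = ∏ i ∈ S, (G i).evalEval a b :=
      map_prod (Polynomial.evalEvalRingHom a b) G S
    have hsum : ∑ i ∈ S, sgn ((G i).evalEval a b) = if 0 ≤ a ∧ 0 ≤ b then 2 else 0 := by
      have := hg ![a, b]
      simp only [← evalEval_aeval_eq_eval] at this
      refine Eq.trans (Finset.sum_subset (Finset.subset_univ S) fun i _ hi => ?_) this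
      have hGi : G i = 0 := by simpa [S] using hi
      simp [hGi, sgn]
    rw [← hsum, hHab]
    exact four_dvd_sum_sgn_sub S _ (Finset.prod_ne_zero_iff.1 (hHab ▸ hab))
  obtain ⟨c, k, hc, hsgn⟩ := exists_sgn_evalEval_neg_eq H hH
  rcases Nat.even_or_odd k with hk | hk
  · obtain ⟨x, hx, hcx⟩ := exists_mem_eval_ne_zero hc (Set.Ioi_infinite (0 : ℝ))
    obtain ⟨δ, hδ, hp, hn, heq⟩ := hsgn x hcx
    have h₁ := hmod _ _ hp
    have h₂ := hmod _ _ hn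
    rw [heq, hk.neg_one_pow, if_neg (fun h => by linarith [h.2])] at h₂
    rw [if_pos ⟨le_of_lt hx, hδ.le⟩] at h₁
    omega
  · obtain ⟨x, hx, hcx⟩ := exists_mem_eval_ne_zero hc (Set.Iio_infinite (0 : ℝ))
    obtain ⟨δ, hδ, hp, hn, heq⟩ := hsgn x hcx
    have h₁ := hmod _ _ hp
    have h₂ := hmod _ _ hn
    have hx' : ¬ 0 ≤ x := not_le.2 hx
    rw [heq, hk.neg_one_pow, if_neg (fun h => hx' h.1)] at h₂
    rw [if_neg (fun h => hx' h.1)] at h₁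
    rcases sgn_eq_one_or_neg_one hp with h | h <;> rw [h] at h₁ h₂ <;> omega
end

section
/- Let Q = {(x, y) ∈ ℝ² : x ≥ 0 and y ≥ 0} be the closed first quadrant. Then the function 4·𝟏_Q : ℝ² → ℤ is not strongly algebraically constructible: there do not exist finitely many real algebraic sets X₁, …, X_k ⊆ ℝ² and integers m₁, …, m_k such that 4·𝟏_Q = Σᵢ mᵢ·𝟏_{Xᵢ}. -/
open MvPolynomial

/-- Finitely many nonzero polynomials over a domain have a common non-root in every product
of infinite sets. -/
theorem MvPolynomial.exists_forall_eval_ne_zero {ι σ R : Type*} [CommRing R] [IsDomain R]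
    [Fintype ι] (h : ι → MvPolynomial σ R) (s : σ → Set R) (hs : ∀ j, (s j).Infinite) :
    ∃ x ∈ Set.univ.pi s, ∀ i, h i ≠ 0 → eval x (h i) ≠ 0 := by
  classical
  by_contra! H
  have hprod : (∏ i with h i ≠ 0, h i) = 0 := by
    refine funext_set s hs fun x hx => ?_
    obtain ⟨i, hi, hix⟩ := H x hx
    rw [map_prod, map_zero]
    exact Finset.prod_eq_zero (by simpa using hi) hix
  exact Finset.prod_ne_zero_iff.2 (fun i hi => (Finset.mem_filter.1 hi).2) hprod

/-- Four times the characteristic function of the closed first quadrant `Q ⊆ ℝ²` is not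
strongly algebraically constructible: it is not a finite integer linear combination of
characteristic functions of real algebraic subsets of `ℝ²`. -/
theorem four_mul_indicator_quadrant_not_strongly_constructible :
    ¬ ∃ (k : ℕ) (m : Fin k → ℤ) (h : Fin k → MvPolynomial (Fin 2) ℝ),
        ∀ x : Fin 2 → ℝ,
          (if 0 ≤ x 0 ∧ 0 ≤ x 1 then (4 : ℤ) else 0) =
            ∑ i : Fin k, m i * (if eval x (h i) = 0 then 1 else 0) := by
  rintro ⟨k, m, h, H⟩
  obtain ⟨x, hx, hx'⟩ :=
    exists_forall_eval_ne_zero h (fun _ => Set.Ici 0) fun _ => Set.Ici_infinite 0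
  obtain ⟨y, hy, hy'⟩ :=
    exists_forall_eval_ne_zero h (fun _ => Set.Iio 0) fun _ => Set.Iio_infinite 0
  have hxy : ∀ i, eval x (h i) = 0 ↔ eval y (h i) = 0 := fun i => by
    by_cases hi : h i = 0
    · simp [hi]
    · simp [hx' i hi, hy' i hi]
  have hQ : 0 ≤ x 0 ∧ 0 ≤ x 1 := ⟨hx 0 trivial, hx 1 trivial⟩
  have hnQ : ¬ (0 ≤ y 0 ∧ 0 ≤ y 1) := fun hc => not_lt.2 hc.1 (hy 0 trivial)
  have hEq := H x
  simp only [hxy] at hEq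
  rw [← H y, if_pos hQ, if_neg hnQ] at hEq
  norm_num at hEq
end
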